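/- Fix N ≥ 1 and let configurations be functions c : ℤ → (Fin N × Fin N) × Equiv.Perm (Fin N), where (c x).1 = (cᴸ x, cᴿ x) is the matter state of cell x and (c x).2 = A x ∈ Perm (Fin N) is the gauge field on the link (x, x+1). Define the extended cellular automaton T by T(c)(x) = ((A x (cᴸ (x+1)), (A (x-1))⁻¹ (cᴿ (x-1))), A x), and for g : ℤ → Equiv.Perm (Fin N) define the gauge transformation γ_g(c)(x) = ((g x (cᴸ x), g x (cᴿ x)), (g x) * (A x) * (g (x+1))⁻¹). Then for every g, T ∘ γ_g = γ_g ∘ T; that is, T is gauge-invariant with Z being the identity. -/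

import Mathlib

/-- The non-abelian gauge-extended transport cellular automaton. -/
def gaugedCA {N : ℕ} (c : ℤ → (Fin N × Fin N) × Equiv.Perm (Fin N)) :
    ℤ → (Fin N × Fin N) × Equiv.Perm (Fin N) :=
  fun x =>
    (((c x).2 (c (x + 1)).1.1, ((c (x - 1)).2)⁻¹ (c (x - 1)).1.2), (c x).2)

/-- The extended gauge transformation induced by a family of permutations. -/
def gaugeTransf {N : ℕ} (g : ℤ → Equiv.Perm (Fin N))
    (c : ℤ → (Fin N × Fin N) × Equiv.Perm (Fin N)) :
    ℤ → (Fin N × Fin N) × Equiv.Perm (Fin N) :=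
  fun x =>
    ((g x (c x).1.1, g x (c x).1.2), g x * (c x).2 * (g (x + 1))⁻¹)

theorem stmt_5 (N : ℕ) (hN : 1 ≤ N) (g : ℤ → Equiv.Perm (Fin N)) :
    (gaugedCA (N := N)) ∘ gaugeTransf g = gaugeTransf g ∘ gaugedCA := by
  funext c x
  simp [gaugedCA, gaugeTransf]
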